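/- arXiv:2504.06556 — 2 statements merged into one kernel-verified Lean document; each statement's English description precedes it below -/
import Mathlib

section
/- For all integers n ≥ 69, A(n, n−5; 3) ≤ n + 6. -/
/-- The tree-distance between two spanning trees on `Fin n`:
`d(T₁,T₂) = n - 1 - |E₁ ∩ E₂|`. -/
noncomputable def treeDist {n : ℕ} (G H : SimpleGraph (Fin n)) : ℕ :=
  n - 1 - (G.edgeSet ∩ H.edgeSet).ncard

/-- An `(n,d)` tree-code: a finite set of (spanning) trees on `Fin n`
such that any two distinct members have tree-distance at least `d`. -/
def IsTreeCode (n d : ℕ) (C : Finset (SimpleGraph (Fin n))) : Prop :=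
  (∀ G ∈ C, G.IsTree) ∧ ∀ G ∈ C, ∀ H ∈ C, G ≠ H → d ≤ treeDist G H

/-- `A n d`: the maximum size of an `(n,d)` tree-code. -/
noncomputable def A (n d : ℕ) : ℕ :=
  sSup {m : ℕ | ∃ C : Finset (SimpleGraph (Fin n)), IsTreeCode n d C ∧ C.card = m}

/-- An `(n,d;i)` tree-code: an `(n,d)` tree-code all of whose trees contain
a common set of at least `i` edges. -/
def IsTreeCodeCommon (n d i : ℕ) (C : Finset (SimpleGraph (Fin n))) : Prop :=
  IsTreeCode n d C ∧
    ∃ E : Finset (Sym2 (Fin n)), i ≤ E.card ∧ ∀ G ∈ C, (E : Set (Sym2 (Fin n))) ⊆ G.edgeSet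

/-- `Acommon n d i`: the maximum size of an `(n,d;i)` tree-code. -/
noncomputable def Acommon (n d i : ℕ) : ℕ :=
  sSup {m : ℕ | ∃ C : Finset (SimpleGraph (Fin n)), IsTreeCodeCommon n d i C ∧ C.card = m}

open Finset in
/-- Double counting: `k`-element subsets of `U` that pairwise meet in at most one point satisfy a
Johnson-type bound, obtained from `(r - 2) * (r - 3) ≥ 0` for the degree `r` of each point. -/
theorem four_mul_card_mul_le_of_card_inter_le_one {ι α : Type*} [DecidableEq ι] [DecidableEq α]
    (C : Finset ι) (U : Finset α) (S : ι → Finset α) (k : ℕ)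
    (hU : ∀ i ∈ C, S i ⊆ U) (hk : ∀ i ∈ C, #(S i) = k)
    (hS : ∀ i ∈ C, ∀ j ∈ C, i ≠ j → #(S i ∩ S j) ≤ 1) :
    4 * #C * k + #C ≤ 6 * #U + #C ^ 2 := by
  let f : α → ι → ℕ := fun e i => if e ∈ S i then 1 else 0
  let r : α → ℕ := fun e => ∑ i ∈ C, f e i
  have card_eq : ∀ T ⊆ U, #T = ∑ e ∈ U, if e ∈ T then 1 else 0 := by
    intro T hT
    rw [Finset.sum_ite_mem, Finset.inter_eq_right.mpr hT]
    simp
  have sum_deg : ∑ e ∈ U, r e = #C * k := by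
    rw [Finset.sum_comm, ← smul_eq_mul, ← Finset.sum_const]
    exact Finset.sum_congr rfl fun i hi => (card_eq _ (hU i hi)).symm.trans (hk i hi)
  have sum_deg_sq : ∑ e ∈ U, r e * r e = ∑ i ∈ C, ∑ j ∈ C, #(S i ∩ S j) := by
    simp only [r, Finset.sum_mul_sum]
    rw [Finset.sum_comm]
    refine Finset.sum_congr rfl fun i hi => ?_
    rw [Finset.sum_comm]
    refine Finset.sum_congr rfl fun j hj => ?_
    rw [card_eq _ (Finset.inter_subset_left.trans (hU i hi))]
    refine Finset.sum_congr rfl fun e _ => ?_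
    by_cases h₁ : e ∈ S i <;> by_cases h₂ : e ∈ S j <;> simp [f, h₁, h₂]
  have sum_inter : ∑ i ∈ C, ∑ j ∈ C, #(S i ∩ S j) + #C ≤ #C * k + #C ^ 2 := by
    have row : ∀ i ∈ C, ∑ j ∈ C, #(S i ∩ S j) + 1 ≤ k + #C := by
      intro i hi
      rw [← Finset.add_sum_erase C _ hi, Finset.inter_self, hk i hi]
      have rest : ∑ j ∈ C.erase i, #(S i ∩ S j) ≤ ∑ j ∈ C.erase i, 1 :=
        Finset.sum_le_sum fun j hj =>
          hS i hi j (Finset.mem_of_mem_erase hj) (Finset.ne_of_mem_erase hj).symm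
      rw [← Finset.card_eq_sum_ones] at rest
      have := Finset.card_erase_add_one hi
      omega
    have total := Finset.sum_le_sum row
    simp only [Finset.sum_add_distrib, Finset.sum_const, smul_eq_mul, mul_one] at total
    rwa [sq]
  have pointwise : ∀ e ∈ U, 5 * r e ≤ r e * r e + 6 := by
    intro e _
    rcases le_or_gt (r e) 2 with h | h <;> nlinarith
  have total := Finset.sum_le_sum pointwise
  rw [← Finset.mul_sum, Finset.sum_add_distrib, sum_deg, sum_deg_sq, Finset.sum_const,
    smul_eq_mul] at total
  linarith

theorem IsTreeCodeCommon.card_le {n : ℕ} (hn : 69 ≤ n) {C : Finset (SimpleGraph (Fin n))}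
    (hC : IsTreeCodeCommon n (n - 5) 3 C) : C.card ≤ n + 6 := by
  classical
  by_contra! hcard
  obtain ⟨⟨tree, dist⟩, E, hE, common⟩ := hC
  obtain ⟨F, hFE, hF⟩ := Finset.exists_subset_card_eq hE
  obtain ⟨D, hDC, hD⟩ := Finset.exists_subset_card_eq (n := n + 7) (s := C) (by omega)
  have hFG : ∀ G ∈ D, F ⊆ G.edgeFinset := fun G hG e he =>
    SimpleGraph.mem_edgeFinset.mpr (common G (hDC hG) (hFE he))
  obtain ⟨G₀, hG₀⟩ : D.Nonempty := Finset.card_pos.mp (by omega)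
  have hFtop : F ⊆ (⊤ : SimpleGraph (Fin n)).edgeFinset :=
    (hFG G₀ hG₀).trans (SimpleGraph.edgeFinset_mono le_top)
  have key := four_mul_card_mul_le_of_card_inter_le_one D
    ((⊤ : SimpleGraph (Fin n)).edgeFinset \ F) (fun G => G.edgeFinset \ F) (n - 4)
    (fun G _ => Finset.sdiff_subset_sdiff (SimpleGraph.edgeFinset_mono le_top) subset_rfl)
    (fun G hG => by
      have := (tree G (hDC hG)).card_edgeFinset
      rw [Fintype.card_fin] at this
      rw [Finset.card_sdiff_of_subset (hFG G hG), hF]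
      omega)
    (fun G hG H hH hne => by
      have hd := dist G (hDC hG) H (hDC hH) hne
      unfold treeDist at hd
      rw [← SimpleGraph.coe_edgeFinset, ← SimpleGraph.coe_edgeFinset, ← Finset.coe_inter,
        Set.ncard_coe_finset] at hd
      have hsdiff : (G.edgeFinset \ F) ∩ (H.edgeFinset \ F)
          = (G.edgeFinset ∩ H.edgeFinset) \ F := by
        ext e
        simp only [Finset.mem_inter, Finset.mem_sdiff]
        tauto
      rw [hsdiff, Finset.card_sdiff_of_subset (Finset.subset_inter (hFG G hG) (hFG H hH)), hF]
      omega)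
  have htop : (⊤ : SimpleGraph (Fin n)).edgeFinset.card * 2 = n * (n - 1) := by
    rw [SimpleGraph.card_edgeFinset_top_eq_card_choose_two, Fintype.card_fin,
      Nat.choose_two_right, Nat.div_mul_cancel (Nat.even_mul_pred_self n).two_dvd]
  have hUcard := Finset.card_sdiff_add_card_eq_card hFtop
  rw [hD] at key
  rw [hF] at hUcard
  obtain ⟨m, rfl⟩ := Nat.exists_eq_add_of_le hn
  rw [show 69 + m - 4 = m + 65 by omega] at key
  rw [show 69 + m - 1 = m + 68 by omega] at htop
  nlinarith

theorem stmt10 (n : ℕ) (hn : 69 ≤ n) : Acommon n (n - 5) 3 ≤ n + 6 := by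
  refine csSup_le' ?_
  rintro m ⟨C, hC, rfl⟩
  exact hC.card_le hn
end

section
/- For all integers n ≥ 117, A(n, n−5) ≤ (n⁴ + 9n³ + 28n² + 92n + 292)/8. -/
open Finset

/-- Double counting of incidences between a family of sets and the points of the ground set. -/
theorem sum_card_filter_mem_eq {ι α : Type*} [DecidableEq α] (s : Finset ι) (f : ι → Finset α)
    (V : Finset α) (hV : ∀ i ∈ s, f i ⊆ V) :
    ∑ e ∈ V, #{i ∈ s | e ∈ f i} = ∑ i ∈ s, #(f i) := by
  simp only [card_filter]
  rw [sum_comm]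
  refine sum_congr rfl fun i hi => ?_
  rw [← card_filter, filter_mem_eq_inter, inter_eq_right.2 (hV i hi)]

/-- Double counting of the points in pairwise intersections of a family of sets. -/
theorem sum_sq_card_filter_mem_eq {ι α : Type*} [DecidableEq α] (s : Finset ι)
    (f : ι → Finset α) (V : Finset α) (hV : ∀ i ∈ s, f i ⊆ V) :
    ∑ e ∈ V, #{i ∈ s | e ∈ f i} ^ 2 = ∑ i ∈ s, ∑ j ∈ s, #(f i ∩ f j) := by
  have h := sum_card_filter_mem_eq (s ×ˢ s) (fun p => f p.1 ∩ f p.2) V fun p hp =>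
    inter_subset_left.trans (hV p.1 (mem_product.1 hp).1)
  rw [sum_product] at h
  rw [← h]
  refine sum_congr rfl fun e _ => ?_
  rw [sq, ← card_product]
  congr 1
  ext p
  simp only [mem_product, mem_filter, mem_inter]
  tauto

/-- A second-moment bound for families of `k`-sets pairwise meeting in at most one point, from
the integer inequality `5 * x ≤ x ^ 2 + 6` for the number `x` of sets through a point. -/
theorem five_mul_card_mul_le {ι α : Type*} [DecidableEq α] (s : Finset ι)
    (f : ι → Finset α) (V : Finset α) (k : ℕ) (hV : ∀ i ∈ s, f i ⊆ V)
    (hk : ∀ i ∈ s, #(f i) = k) (hf : ∀ i ∈ s, ∀ j ∈ s, i ≠ j → #(f i ∩ f j) ≤ 1) :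
    5 * (#s * k) ≤ #s * (k + (#s - 1)) + 6 * #V := by
  classical
  have hpoint : ∀ x : ℕ, 5 * x ≤ x ^ 2 + 6 := fun x => by
    rcases le_or_gt x 2 with h | h
    · interval_cases x <;> norm_num
    · obtain ⟨y, rfl⟩ := Nat.exists_eq_add_of_lt h
      nlinarith
  have hrow : ∀ i ∈ s, ∑ j ∈ s, #(f i ∩ f j) ≤ k + (#s - 1) := fun i hi => by
    rw [← add_sum_erase s _ hi, inter_self, hk i hi]
    gcongr
    calc ∑ j ∈ s.erase i, #(f i ∩ f j) ≤ ∑ _j ∈ s.erase i, 1 :=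
          sum_le_sum fun j hj =>
            hf i hi j (mem_of_mem_erase hj) (ne_of_mem_erase hj).symm
      _ = #s - 1 := by rw [← card_eq_sum_ones, card_erase_of_mem hi]
  calc 5 * (#s * k) = ∑ e ∈ V, 5 * #{i ∈ s | e ∈ f i} := by
        rw [← mul_sum, sum_card_filter_mem_eq s f V hV, sum_congr rfl hk, sum_const, smul_eq_mul]
    _ ≤ ∑ e ∈ V, (#{i ∈ s | e ∈ f i} ^ 2 + 6) := sum_le_sum fun e _ => hpoint _
    _ = ∑ i ∈ s, ∑ j ∈ s, #(f i ∩ f j) + 6 * #V := by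
        rw [sum_add_distrib, sum_sq_card_filter_mem_eq s f V hV, sum_const, smul_eq_mul,
          mul_comm (#V)]
    _ ≤ #s * (k + (#s - 1)) + 6 * #V := by
        gcongr
        simpa using sum_le_sum hrow

/-- Johnson-type averaging: a bound for the subfamilies containing `i + 1` prescribed points gives
a bound for the subfamilies containing `i` prescribed points. -/
theorem card_filter_subset_mul_le {ι α : Type*} [DecidableEq α] (s : Finset ι)
    (f : ι → Finset α) (V : Finset α) (k i B : ℕ) (hV : ∀ j ∈ s, f j ⊆ V)
    (hk : ∀ j ∈ s, #(f j) = k)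
    (hB : ∀ E ⊆ V, #E = i + 1 → #{j ∈ s | E ⊆ f j} ≤ B) (E : Finset α) (hE : E ⊆ V)
    (hEi : #E = i) : #{j ∈ s | E ⊆ f j} * (k - i) ≤ (#V - i) * B := by
  have hcount := sum_card_filter_mem_eq {j ∈ s | E ⊆ f j} (fun j => f j \ E) (V \ E)
    fun j hj => sdiff_subset_sdiff (hV j (mem_filter.1 hj).1) le_rfl
  have hsize : ∀ j ∈ ({j ∈ s | E ⊆ f j} : Finset ι), #(f j \ E) = k - i := fun j hj => by
    rw [card_sdiff_of_subset (mem_filter.1 hj).2, hk j (mem_filter.1 hj).1, hEi]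
  rw [sum_congr rfl hsize, sum_const, smul_eq_mul] at hcount
  rw [← hcount, ← hEi, ← card_sdiff_of_subset hE, ← smul_eq_mul]
  refine sum_le_card_nsmul _ _ _ fun e he => ?_
  rw [mem_sdiff] at he
  refine le_trans (card_le_card fun j hj => ?_)
    (hB (insert e E) (insert_subset he.1 hE) (by rw [card_insert_of_notMem he.2, hEi]))
  simp only [mem_filter, mem_sdiff] at hj ⊢
  exact ⟨hj.1.1, insert_subset hj.2.1 hj.1.2⟩

/-- A family of `(n - 1)`-sets in a ground set of `n.choose 2` points, pairwise meeting in at most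
four points, has at most `n + 6` members containing three prescribed points. -/
theorem card_filter_subset_le_add_six {ι α : Type*} [DecidableEq α] (s : Finset ι)
    (f : ι → Finset α) (V : Finset α) (n : ℕ) (hn : 69 ≤ n) (hVn : #V = n.choose 2)
    (hV : ∀ j ∈ s, f j ⊆ V) (hk : ∀ j ∈ s, #(f j) = n - 1)
    (hf : ∀ i ∈ s, ∀ j ∈ s, i ≠ j → #(f i ∩ f j) ≤ 4) (E : Finset α) (hE : E ⊆ V)
    (hE3 : #E = 3) : #{j ∈ s | E ⊆ f j} ≤ n + 6 := by
  by_contra! hlt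
  obtain ⟨t, hts, ht⟩ := exists_subset_card_eq (Nat.succ_le_of_lt hlt)
  have hmem : ∀ j ∈ t, j ∈ s ∧ E ⊆ f j := fun j hj => mem_filter.1 (hts hj)
  have h := five_mul_card_mul_le t (fun j => f j \ E) (V \ E) (n - 1 - 3)
    (fun j hj => sdiff_subset_sdiff (hV j (hmem j hj).1) le_rfl)
    (fun j hj => by rw [card_sdiff_of_subset (hmem j hj).2, hk j (hmem j hj).1, hE3])
    (fun i hi j hj hij => by
      rw [show (f i \ E) ∩ (f j \ E) = (f i ∩ f j) \ E by ext; simp; tauto,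
        card_sdiff_of_subset (subset_inter (hmem i hi).2 (hmem j hj).2), hE3]
      have := hf i (hmem i hi).1 j (hmem j hj).1 hij
      omega)
  rw [card_sdiff_of_subset hE, hE3, ht, hVn, Nat.choose_two_right] at h
  obtain ⟨m, rfl⟩ := Nat.exists_eq_add_of_le hn
  have hdiv : (69 + m) * (69 + m - 1) / 2 * 2 = (69 + m) * (68 + m) := by
    rw [Nat.div_mul_cancel (Nat.even_mul_pred_self _).two_dvd]
    congr 1
    omega
  generalize (69 + m) * (69 + m - 1) / 2 = N at h hdiv
  have hN : 3 ≤ N := by nlinarith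
  obtain ⟨N, rfl⟩ := Nat.exists_eq_add_of_le hN
  rw [show 69 + m - 1 - 3 = 65 + m by omega,
    show (69 + m + 6).succ = 76 + m by omega, show 76 + m - 1 = 75 + m by omega,
    Nat.add_sub_cancel_left] at h
  nlinarith

/-- The size bound for families of `(n - 1)`-sets in a ground set of `n.choose 2` points pairwise
meeting in at most four points. -/
theorem card_mul_le_of_card_inter_le_four {ι α : Type*} [DecidableEq α] (s : Finset ι)
    (f : ι → Finset α) (V : Finset α) (n : ℕ) (hn : 69 ≤ n) (hVn : #V = n.choose 2)
    (hV : ∀ j ∈ s, f j ⊆ V) (hk : ∀ j ∈ s, #(f j) = n - 1)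
    (hf : ∀ i ∈ s, ∀ j ∈ s, i ≠ j → #(f i ∩ f j) ≤ 4) :
    8 * (#s * (n - 3)) ≤ n * (n + 1) * (n * (n - 1) - 4) * (n + 6) := by
  have htwo : n.choose 2 * 2 = n * (n - 1) := by
    rw [Nat.choose_two_right, Nat.div_mul_cancel (Nat.even_mul_pred_self _).two_dvd]
  have hthree := card_filter_subset_le_add_six s f V n hn hVn hV hk hf
  have hsecond : ∀ E ⊆ V, #E = 2 →
      #{j ∈ s | E ⊆ f j} ≤ (n.choose 2 - 2) * (n + 6) / (n - 3) := fun E hE hE2 => by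
    rw [Nat.le_div_iff_mul_le (by omega)]
    simpa [hVn, Nat.sub_sub] using
      card_filter_subset_mul_le s f V (n - 1) 2 (n + 6) hV hk hthree E hE hE2
  set B := (n.choose 2 - 2) * (n + 6) / (n - 3)
  have hBmul : B * (n - 3) ≤ (n.choose 2 - 2) * (n + 6) := Nat.div_mul_le_self _ _
  have hfirst : ∀ E ⊆ V, #E = 1 → #{j ∈ s | E ⊆ f j} ≤ (n + 1) * B / 2 := fun E hE hE1 => by
    have h := card_filter_subset_mul_le s f V (n - 1) 1 B hV hk hsecond E hE hE1
    rw [Nat.le_div_iff_mul_le (by omega)]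
    rw [hVn, Nat.sub_sub] at h
    obtain ⟨m, rfl⟩ := Nat.exists_eq_add_of_le hn
    rw [show 69 + m - 1 = 68 + m by omega] at htwo
    rw [show 69 + m - (1 + 1) = 67 + m by omega] at h
    have hchoose : ((69 + m).choose 2 - 1) * 2 = (67 + m) * (70 + m) := by
      rw [Nat.sub_mul, htwo]
      have : (69 + m) * (68 + m) = (67 + m) * (70 + m) + 2 := by ring
      omega
    refine Nat.le_of_mul_le_mul_left (c := 67 + m) ?_ (by omega)
    calc _ = #{j ∈ s | E ⊆ f j} * (67 + m) * 2 := by ring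
      _ ≤ ((69 + m).choose 2 - 1) * B * 2 := by gcongr
      _ = ((69 + m).choose 2 - 1) * 2 * B := by ring
      _ = (67 + m) * ((69 + m + 1) * B) := by rw [hchoose]; ring
  set D := (n + 1) * B / 2
  have hDmul : D * 2 ≤ (n + 1) * B := Nat.div_mul_le_self _ _
  have hall : #s * 2 ≤ n * D := by
    have h := card_filter_subset_mul_le s f V (n - 1) 0 D hV hk hfirst ∅ (empty_subset _) rfl
    simp only [empty_subset, filter_true, Nat.sub_zero, hVn] at h
    refine Nat.le_of_mul_le_mul_left (c := n - 1) ?_ (by omega)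
    calc _ = #s * (n - 1) * 2 := by ring
      _ ≤ n.choose 2 * D * 2 := by gcongr
      _ = n.choose 2 * 2 * D := by ring
      _ = (n - 1) * (n * D) := by rw [htwo]; ring
  calc 8 * (#s * (n - 3)) = #s * 2 * (4 * (n - 3)) := by ring
    _ ≤ n * D * (4 * (n - 3)) := by gcongr
    _ = n * (D * 2) * (2 * (n - 3)) := by ring
    _ ≤ n * ((n + 1) * B) * (2 * (n - 3)) := by gcongr
    _ = n * (n + 1) * 2 * (B * (n - 3)) := by ring
    _ ≤ n * (n + 1) * 2 * ((n.choose 2 - 2) * (n + 6)) := by gcongr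
    _ = n * (n + 1) * ((n.choose 2 - 2) * 2) * (n + 6) := by ring
    _ = n * (n + 1) * (n * (n - 1) - 4) * (n + 6) := by rw [Nat.sub_mul, htwo]

theorem IsTreeCode.card_mul_le {n : ℕ} (hn : 69 ≤ n) {C : Finset (SimpleGraph (Fin n))}
    (hC : IsTreeCode n (n - 5) C) :
    8 * (#C * (n - 3)) ≤ n * (n + 1) * (n * (n - 1) - 4) * (n + 6) := by
  classical
  refine card_mul_le_of_card_inter_le_four C (fun G => G.edgeFinset)
    (⊤ : SimpleGraph (Fin n)).edgeFinset n hn ?_ ?_ ?_ ?_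
  · rw [SimpleGraph.card_edgeFinset_top_eq_card_choose_two, Fintype.card_fin]
  · exact fun G _ => SimpleGraph.edgeFinset_mono le_top
  · intro G hG
    have h := (hC.1 G hG).card_edgeFinset
    rw [Fintype.card_fin] at h
    omega
  · intro G hG H hH hGH
    have h := hC.2 G hG H hH hGH
    rw [treeDist, ← SimpleGraph.coe_edgeFinset G, ← SimpleGraph.coe_edgeFinset H, ← coe_inter,
      Set.ncard_coe_finset] at h
    omega

theorem stmt13 (n : ℕ) (hn : 117 ≤ n) :
    (A n (n - 5) : ℝ) ≤
      ((n : ℝ) ^ 4 + 9 * (n : ℝ) ^ 3 + 28 * (n : ℝ) ^ 2 + 92 * (n : ℝ) + 292) / 8 := by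
  refine (Nat.le_floor_iff (by positivity)).1 (csSup_le' ?_)
  rintro _ ⟨C, hC, rfl⟩
  rw [Nat.le_floor_iff (by positivity)]
  have h := hC.card_mul_le (by omega)
  obtain ⟨m, rfl⟩ := Nat.exists_eq_add_of_le hn
  have hsub : (117 + m) * (117 + m - 1) - 4 = m ^ 2 + 233 * m + 13568 := by
    rw [show 117 + m - 1 = 116 + m by omega, Nat.sub_eq_iff_eq_add (by nlinarith)]
    ring
  rw [hsub, show 117 + m - 3 = 114 + m by omega] at h
  have hreal : 8 * ((#C : ℝ) * (114 + m)) ≤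
      (117 + m) * (117 + m + 1) * ((m : ℝ) ^ 2 + 233 * m + 13568) * (117 + m + 6) := by
    exact_mod_cast h
  push_cast
  rw [le_div_iff₀ (by norm_num)]
  refine le_of_mul_le_mul_right (a := (114 + m : ℝ)) ?_ (by positivity)
  calc (#C : ℝ) * 8 * (114 + m) = 8 * (#C * (114 + m)) := by ring
    _ ≤ _ := hreal
    _ ≤ _ := by
      rw [← sub_nonneg]
      ring_nf
      positivity
end
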